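/- arXiv:math/0305370 — 5 statements merged into one kernel-verified Lean document; each statement's English description precedes it below -/
import Mathlib

section
/- Let (Λ,d) be a finitely aligned k-graph, E ⊆ Λ finite, and {t_λ : λ ∈ Λ} a Cuntz–Krieger Λ-family. Then for all λ,μ ∈ ΠE with d(λ) = d(μ) and s(λ) = s(μ): t_λ t_μ* = Σ Θ(t,E;λν,μν), where the sum is over all ν ∈ s(λ)Λ (including ν = s(λ)) such that λν ∈ ΠE. -/
open scoped BigOperators

/-- A `k`-graph: a countable small category (in arrows-only presentation, with objects
identified with the identity morphisms) together with a degree functor into `ℕ^k`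
satisfying the factorisation property.  `comp l m` is the composite path `lm`
(first `m`, then `l` in categorical order; range `rng l`, source `src m`), and is
only meaningful when `src l = rng m`. -/
structure KGraph (k : ℕ) where
  Path : Type
  countable : Countable Path
  src : Path → Path
  rng : Path → Path
  comp : Path → Path → Path
  deg : Path → Fin k → ℕ
  deg_src : ∀ l, deg (src l) = 0
  deg_rng : ∀ l, deg (rng l) = 0
  src_eq_of_deg_zero : ∀ v, deg v = 0 → src v = v
  rng_eq_of_deg_zero : ∀ v, deg v = 0 → rng v = v
  comp_src_self : ∀ l, comp l (src l) = l
  rng_comp_self : ∀ l, comp (rng l) l = l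
  src_comp : ∀ l m, src l = rng m → src (comp l m) = src m
  rng_comp : ∀ l m, src l = rng m → rng (comp l m) = rng l
  deg_comp : ∀ l m, src l = rng m → deg (comp l m) = deg l + deg m
  comp_assoc : ∀ l m n, src l = rng m → src m = rng n →
    comp (comp l m) n = comp l (comp m n)
  factorisation : ∀ (l : Path) (m n : Fin k → ℕ), deg l = m + n →
    ∃! p : Path × Path, deg p.1 = m ∧ deg p.2 = n ∧ src p.1 = rng p.2 ∧
      comp p.1 p.2 = l

namespace KGraph

variable {k : ℕ} (Λ : KGraph k)

/-- The vertices of a `k`-graph are the paths of degree `0`. -/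
def IsVertex (v : Λ.Path) : Prop := Λ.deg v = 0

/-- An edge is a path of degree `e_i` for some `i`. -/
def IsEdge (e : Λ.Path) : Prop := ∃ i : Fin k, Λ.deg e = Pi.single i 1

/-- `vΛ`, the set of paths with range `v`. -/
def withRange (v : Λ.Path) : Set Λ.Path := {l | Λ.rng l = v}

/-- `Λ^min(l,m)`, the set of pairs giving minimal common extensions of `l` and `m`. -/
def minExt (l m : Λ.Path) : Set (Λ.Path × Λ.Path) :=
  {p | Λ.src l = Λ.rng p.1 ∧ Λ.src m = Λ.rng p.2 ∧
    Λ.comp l p.1 = Λ.comp m p.2 ∧ Λ.deg (Λ.comp l p.1) = Λ.deg l ⊔ Λ.deg m}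

/-- A `k`-graph is finitely aligned if all the sets `Λ^min(l,m)` are finite. -/
def FinitelyAligned : Prop := ∀ l m, (Λ.minExt l m).Finite

/-- A subset `E ⊆ vΛ` is exhaustive if every path in `vΛ` has a common extension
with some member of `E`. -/
def Exhaustive (v : Λ.Path) (E : Set Λ.Path) : Prop :=
  ∀ m ∈ Λ.withRange v, ∃ l ∈ E, (Λ.minExt l m).Nonempty

/-- `Λ^{≤ n}`. -/
def degLe (n : Fin k → ℕ) : Set Λ.Path :=
  {l | Λ.deg l ≤ n ∧ ∀ i : Fin k, Λ.deg l i < n i →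
    ¬∃ e, Λ.rng e = Λ.src l ∧ Λ.deg e = Pi.single i 1}

end KGraph

open Classical in
/-- The sum of `f` over a set `S`, defined to be `0` if `S` is infinite. -/
noncomputable def setSum {ι A : Type*} [AddCommMonoid A] (S : Set ι) (f : ι → A) : A :=
  if h : S.Finite then ∑ i ∈ h.toFinset, f i else 0

open Classical in
/-- The product of `f` over a set `S` taken in an arbitrary (but fixed) order,
defined to be `1` if `S` is infinite.  All products appearing below have commuting
factors, for which this is the usual product over a finite set. -/
noncomputable def setProd {ι A : Type*} [Monoid A] (S : Set ι) (f : ι → A) : A :=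
  if h : S.Finite then (h.toFinset.toList.map f).prod else 1

namespace KGraph

variable {k : ℕ} (Λ : KGraph k) {A : Type*} [Ring A] [StarRing A]

/-- Relations (CK1)–(CK3) for a family of partial isometries indexed by a `k`-graph. -/
structure IsCK13 (t : Λ.Path → A) : Prop where
  partialIsometry : ∀ l, t l * star (t l) * t l = t l
  vertex_projection : ∀ v, Λ.IsVertex v → star (t v) = t v ∧ t v * t v = t v
  vertex_orthogonal : ∀ v w, Λ.IsVertex v → Λ.IsVertex w → v ≠ w → t v * t w = 0
  comp_mul : ∀ l m, Λ.src l = Λ.rng m → t l * t m = t (Λ.comp l m)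
  ck3 : ∀ l m, star (t l) * t m =
    setSum (Λ.minExt l m) fun p => t p.1 * star (t p.2)

/-- A Cuntz–Krieger `Λ`-family: relations (CK1)–(CK4). -/
structure IsCKFamily (t : Λ.Path → A) extends IsCK13 Λ t : Prop where
  ck4 : ∀ v E, Λ.IsVertex v → E ⊆ Λ.withRange v → E.Finite → Λ.Exhaustive v E →
    setProd E (fun l => t v - t l * star (t l)) = 0

/-- Condition (†) on a subset `F ⊆ Λ`. -/
def DaggerClosed (F : Set Λ.Path) : Prop :=
  ∀ l m σ τ a b, l ∈ F → m ∈ F → σ ∈ F → τ ∈ F →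
    Λ.deg l = Λ.deg m → Λ.deg σ = Λ.deg τ →
    Λ.src l = Λ.src m → Λ.src σ = Λ.src τ →
    (a, b) ∈ Λ.minExt m σ → Λ.comp l a ∈ F ∧ Λ.comp τ b ∈ F

/-- `ΠE`, the smallest subset of `Λ` containing `E` and satisfying (†). -/
def piSet (E : Set Λ.Path) : Set Λ.Path := ⋂₀ {F | E ⊆ F ∧ Λ.DaggerClosed F}

/-- For `P ⊆ Λ` and a path `l`, the set `{ν ∈ s(l)Λ : d(ν) > 0 and lν ∈ P}`;
with `P = ΠE` this is the set `T(l)`. -/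
def extInto (P : Set Λ.Path) (l : Λ.Path) : Set Λ.Path :=
  {ν | Λ.src l = Λ.rng ν ∧ Λ.deg ν ≠ 0 ∧ Λ.comp l ν ∈ P}

/-- The projection `Q(t)^{ΠE}_l`. -/
noncomputable def Qproj (t : Λ.Path → A) (E : Set Λ.Path) (l : Λ.Path) : A :=
  t l * star (t l) *
    setProd (Λ.extInto (Λ.piSet E) l)
      (fun ν => t l * star (t l) - t (Λ.comp l ν) * star (t (Λ.comp l ν)))

/-- The matrix unit `Θ(t,E;l,m) = Q(t)^{ΠE}_l t_l t_m^*`. -/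
noncomputable def Theta (t : Λ.Path → A) (E : Set Λ.Path) (l m : Λ.Path) : A :=
  Λ.Qproj t E l * (t l * star (t m))

end KGraph

/-- A degree-preserving functor `x : Ω_{k,m} → Λ` for some `m ∈ (ℕ ∪ {∞})^k`,
recorded by its degree `m` and its values `map p q` on the morphisms `(p,q)` of
`Ω_{k,m}` (normalised to the junk value `map 0 0` on pairs `(p,q)` that are not
morphisms of `Ω_{k,m}`). -/
structure OmegaMor {k : ℕ} (Λ : KGraph k) where
  m : Fin k → ℕ∞
  map : (Fin k → ℕ) → (Fin k → ℕ) → Λ.Path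
  deg_map : ∀ p q : Fin k → ℕ, p ≤ q → (∀ i, (q i : ℕ∞) ≤ m i) →
    Λ.deg (map p q) = q - p
  rng_map : ∀ p q : Fin k → ℕ, p ≤ q → (∀ i, (q i : ℕ∞) ≤ m i) →
    Λ.rng (map p q) = map p p
  src_map : ∀ p q : Fin k → ℕ, p ≤ q → (∀ i, (q i : ℕ∞) ≤ m i) →
    Λ.src (map p q) = map q q
  comp_map : ∀ p q r : Fin k → ℕ, p ≤ q → q ≤ r → (∀ i, (r i : ℕ∞) ≤ m i) →
    Λ.comp (map p q) (map q r) = map p r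
  map_default : ∀ p q : Fin k → ℕ, ¬(p ≤ q ∧ ∀ i, (q i : ℕ∞) ≤ m i) →
    map p q = map 0 0

/-- `x` is a boundary path: there is `n_x ≤ m` such that whenever `n_x ≤ n ≤ m`
and `n_i = m_i`, the vertex `x(n)` receives no edge of degree `e_i`. -/
def OmegaMor.IsBoundary {k : ℕ} {Λ : KGraph k} (x : OmegaMor Λ) : Prop :=
  ∃ nx : Fin k → ℕ, (∀ i, (nx i : ℕ∞) ≤ x.m i) ∧
    ∀ n : Fin k → ℕ, nx ≤ n → (∀ i, (n i : ℕ∞) ≤ x.m i) →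
      ∀ i : Fin k, (n i : ℕ∞) = x.m i →
        ¬∃ e, Λ.rng e = x.map n n ∧ Λ.deg e = Pi.single i 1


namespace KGraph

variable {k : ℕ} {Λ : KGraph k}

theorem comp_inj {a b c d : Λ.Path} (hab : Λ.src a = Λ.rng b) (hcd : Λ.src c = Λ.rng d)
    (hdeg : Λ.deg a = Λ.deg c) (h : Λ.comp a b = Λ.comp c d) : a = c ∧ b = d := by
  have hd : Λ.deg b = Λ.deg d := by
    have := congrArg Λ.deg h
    rw [Λ.deg_comp _ _ hab, Λ.deg_comp _ _ hcd, hdeg] at this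
    exact add_left_cancel this
  have := (Λ.factorisation (Λ.comp a b) _ _ (Λ.deg_comp a b hab)).unique
    (y₁ := (a, b)) (y₂ := (c, d)) ⟨rfl, rfl, hab, rfl⟩ ⟨hdeg.symm, hd.symm, hcd, h.symm⟩
  simpa using this

theorem eq_src_of_deg_eq_zero {a b : Λ.Path} (hab : Λ.src a = Λ.rng b) (h : Λ.deg b = 0) :
    b = Λ.src a := by
  rw [hab, Λ.rng_eq_of_deg_zero b h]

theorem comp_of_deg_eq_zero {a b : Λ.Path} (hab : Λ.src a = Λ.rng b) (h : Λ.deg b = 0) :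
    Λ.comp a b = a := by
  rw [eq_src_of_deg_eq_zero hab h, Λ.comp_src_self]

theorem rng_src (a : Λ.Path) : Λ.rng (Λ.src a) = Λ.src a :=
  Λ.rng_eq_of_deg_zero _ (Λ.deg_src a)

theorem exists_factor {x : Λ.Path} {m : Fin k → ℕ} (h : m ≤ Λ.deg x) :
    ∃ y z, Λ.deg y = m ∧ Λ.src y = Λ.rng z ∧ Λ.comp y z = x := by
  obtain ⟨⟨y, z⟩, ⟨h1, -, h3, h4⟩, -⟩ :=
    Λ.factorisation x m (Λ.deg x - m) (add_tsub_cancel_of_le h).symm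
  exact ⟨y, z, h1, h3, h4⟩

/-- If `y` is an initial segment of `comp a b` at least as long as `a`, then `y` extends `a`. -/
theorem exists_comp_eq_of_le {a b y z : Λ.Path} (hab : Λ.src a = Λ.rng b)
    (hyz : Λ.src y = Λ.rng z) (h : Λ.comp y z = Λ.comp a b) (hle : Λ.deg a ≤ Λ.deg y) :
    ∃ c, Λ.src a = Λ.rng c ∧ Λ.comp a c = y ∧ Λ.src c = Λ.rng z ∧ Λ.comp c z = b := by
  obtain ⟨a', c, h1, h2, rfl⟩ := exists_factor hle
  rw [Λ.src_comp _ _ h2] at hyz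
  rw [Λ.comp_assoc _ _ _ h2 hyz] at h
  obtain ⟨rfl, h4⟩ := comp_inj (by rw [Λ.rng_comp _ _ hyz, h2]) hab h1 h
  exact ⟨c, h2, rfl, hyz, h4⟩

/-- A common extension of two paths factors through a minimal one. -/
theorem exists_minExt {a b c d : Λ.Path} (hab : Λ.src a = Λ.rng b) (hcd : Λ.src c = Λ.rng d)
    (h : Λ.comp a b = Λ.comp c d) :
    ∃ u v z, (u, v) ∈ Λ.minExt a c ∧ Λ.src u = Λ.rng z ∧ Λ.src v = Λ.rng z ∧
      Λ.comp u z = b ∧ Λ.comp v z = d := by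
  have ha : Λ.deg a ≤ Λ.deg (Λ.comp a b) := by
    rw [Λ.deg_comp _ _ hab]; exact le_self_add
  have hc : Λ.deg c ≤ Λ.deg (Λ.comp a b) := by
    rw [h, Λ.deg_comp _ _ hcd]; exact le_self_add
  obtain ⟨y, z, hy, hyz, hx⟩ := exists_factor (sup_le ha hc)
  obtain ⟨u, hu1, hu2, hu3, hu4⟩ := exists_comp_eq_of_le hab hyz hx (hy ▸ le_sup_left)
  obtain ⟨v, hv1, hv2, hv3, hv4⟩ :=
    exists_comp_eq_of_le hcd hyz (hx.trans h) (hy ▸ le_sup_right)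
  exact ⟨u, v, z, ⟨hu1, hv1, hu2.trans hv2.symm, by rw [hu2, hy]⟩, hu3, hv3, hu4, hv4⟩

theorem minExt_symm {a c u v : Λ.Path} (h : (u, v) ∈ Λ.minExt a c) : (v, u) ∈ Λ.minExt c a := by
  obtain ⟨h1, h2, h3, h4⟩ := h
  exact ⟨h2, h1, h3.symm, by rw [sup_comm, ← h4]; exact congrArg Λ.deg h3.symm⟩

/-- One half of condition (†) implies the other by symmetry. -/
theorem daggerClosed_of_left {F : Set Λ.Path}
    (h : ∀ l m σ a b, l ∈ F → m ∈ F → σ ∈ F → Λ.deg l = Λ.deg m → Λ.src l = Λ.src m →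
      (a, b) ∈ Λ.minExt m σ → Λ.comp l a ∈ F) : Λ.DaggerClosed F :=
  fun l m σ τ a b hl hm hσ hτ hd hd' hs hs' hab =>
    ⟨h l m σ a b hl hm hσ hd hs hab, h τ σ m b a hτ hσ hm hd'.symm hs'.symm (minExt_symm hab)⟩

theorem DaggerClosed.left {F : Set Λ.Path} (hF : Λ.DaggerClosed F) {l m σ a b : Λ.Path}
    (hl : l ∈ F) (hm : m ∈ F) (hσ : σ ∈ F) (hd : Λ.deg l = Λ.deg m) (hs : Λ.src l = Λ.src m)
    (hab : (a, b) ∈ Λ.minExt m σ) : Λ.comp l a ∈ F :=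
  (hF l m σ σ a b hl hm hσ hσ hd rfl hs rfl hab).1

theorem daggerClosed_piSet (E : Set Λ.Path) : Λ.DaggerClosed (Λ.piSet E) :=
  daggerClosed_of_left fun _ _ _ _ _ hl hm hσ hd hs hab F hF =>
    hF.2.left (hl F hF) (hm F hF) (hσ F hF) hd hs hab

theorem subset_piSet (E : Set Λ.Path) : E ⊆ Λ.piSet E :=
  Set.subset_sInter fun _ hF => hF.1

theorem piSet_subset {E F : Set Λ.Path} (hEF : E ⊆ F) (hF : Λ.DaggerClosed F) :
    Λ.piSet E ⊆ F :=
  Set.sInter_subset_of_mem ⟨hEF, hF⟩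

theorem deg_le_of_mem_piSet {E : Set Λ.Path} {N : Fin k → ℕ} (hN : ∀ x ∈ E, Λ.deg x ≤ N) :
    ∀ x ∈ Λ.piSet E, Λ.deg x ≤ N := by
  refine piSet_subset (F := {x | Λ.deg x ≤ N}) hN (daggerClosed_of_left ?_)
  rintro l m σ a b hl hm hσ hd hs ⟨h1, h2, h3, h4⟩
  have : Λ.deg (Λ.comp l a) = Λ.deg (Λ.comp m a) := by
    rw [Λ.deg_comp _ _ h1, Λ.deg_comp _ _ (hs.trans h1), hd]
  change Λ.deg (Λ.comp l a) ≤ N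
  rw [this, h4]
  exact sup_le hm hσ

theorem finite_tails {B : Set Λ.Path} (hB : B.Finite) :
    {γ | ∃ ρ, Λ.src ρ = Λ.rng γ ∧ Λ.comp ρ γ ∈ B}.Finite := by
  refine (hB.biUnion fun x _ => (Set.finite_Iic (Λ.deg x)).biUnion fun p _ =>
    (show Set.Finite {γ | ∃ ρ, Λ.src ρ = Λ.rng γ ∧ Λ.comp ρ γ = x ∧ Λ.deg ρ = p} from
      Set.Subsingleton.finite ?_)).subset ?_
  · rintro γ ⟨ρ, h1, h2, h3⟩ γ' ⟨ρ', h1', h2', h3'⟩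
    exact (comp_inj h1 h1' (h3.trans h3'.symm) (h2.trans h2'.symm)).2
  · rintro γ ⟨ρ, h1, h2⟩
    simp only [Set.mem_iUnion]
    exact ⟨_, h2, Λ.deg ρ, by
      rw [Set.mem_Iic, Λ.deg_comp _ _ h1]; exact le_self_add, ρ, h1, rfl, rfl⟩

theorem finite_piSet_inter_deg (hΛ : Λ.FinitelyAligned) {E : Set Λ.Path} (hE : E.Finite)
    (n : Fin k → ℕ) : {x | x ∈ Λ.piSet E ∧ Λ.deg x = n}.Finite := by
  induction n using WellFoundedLT.induction with
  | ind n ih =>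
  have hP := daggerClosed_piSet E
  set P := Λ.piSet E with hPdef
  set L : Set Λ.Path := {x | x ∈ P ∧ Λ.deg x < n} with hL
  have hLfin : L.Finite := by
    refine (((Set.finite_Iic n).subset Set.Iio_subset_Iic_self).biUnion
      fun p hp => ih p hp).subset ?_
    rintro x ⟨hx, hxn⟩
    simp only [Set.mem_iUnion]
    exact ⟨_, hxn, hx, rfl⟩
  set C₁ : Set Λ.Path :=
    {x | ∃ l ∈ L, ∃ m ∈ L, ∃ σ ∈ L, ∃ p ∈ Λ.minExt m σ, Λ.comp l p.1 = x} with hC₁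
  have hC₁fin : C₁.Finite := by
    refine (hLfin.biUnion fun l _ => hLfin.biUnion fun m _ => hLfin.biUnion fun σ _ =>
      (hΛ m σ).image fun p => Λ.comp l p.1).subset ?_
    rintro x ⟨l, hl, m, hm, σ, hσ, p, hp, rfl⟩
    simp only [Set.mem_iUnion]
    exact ⟨l, hl, m, hm, σ, hσ, p, hp, rfl⟩
  set T : Set Λ.Path := {γ | ∃ ρ, Λ.src ρ = Λ.rng γ ∧ Λ.comp ρ γ ∈ E ∪ C₁} with hT
  have hTfin : T.Finite := finite_tails (hE.union hC₁fin)
  set C : Set Λ.Path := {x | x ∈ E ∪ C₁ ∨ ∃ ρ ∈ L, ∃ γ ∈ T, Λ.src ρ = Λ.rng γ ∧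
    Λ.comp ρ γ = x} with hC
  have hCfin : C.Finite := by
    refine ((hE.union hC₁fin).union ((hLfin.prod hTfin).image
      fun p => Λ.comp p.1 p.2)).subset ?_
    rintro x (hx | ⟨ρ, hρ, γ, hγ, -, rfl⟩)
    · exact Or.inl hx
    · exact Or.inr ⟨(ρ, γ), ⟨hρ, hγ⟩, rfl⟩
  suffices h : P ⊆ {x | x ∈ P ∧ (Λ.deg x = n → x ∈ C)} from
    hCfin.subset fun x hx => (h hx.1).2 hx.2
  refine piSet_subset (fun x hx => ⟨subset_piSet E hx, fun _ => Or.inl (Or.inl hx)⟩)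
    (daggerClosed_of_left ?_)
  rintro l m σ a b ⟨hl, hl'⟩ ⟨hm, -⟩ ⟨hσ, hσ'⟩ hd hs hab
  refine ⟨hP.left hl hm hσ hd hs hab, fun hn => ?_⟩
  obtain ⟨h1, h2, h3, h4⟩ := id hab
  simp only at h1 h2 h3 h4
  have hla : Λ.src l = Λ.rng a := hs.trans h1
  have hsup : Λ.deg m ⊔ Λ.deg σ = n := by
    rw [← h4, ← hn, Λ.deg_comp _ _ h1, Λ.deg_comp _ _ hla, hd]
  rcases (hsup ▸ le_sup_left : Λ.deg m ≤ n).eq_or_lt with hmn | hmn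
  · have ha0 : Λ.deg a = 0 := by
      rw [Λ.deg_comp _ _ hla, hd, hmn] at hn
      exact add_eq_left.mp hn
    rw [comp_of_deg_eq_zero hla ha0]
    exact hl' (hd.trans hmn)
  have hlL : l ∈ L := ⟨hl, hd ▸ hmn⟩
  have hmL : m ∈ L := ⟨hm, hmn⟩
  rcases (hsup ▸ le_sup_right : Λ.deg σ ≤ n).eq_or_lt with hσn | hσn
  swap
  · exact Or.inl (Or.inr ⟨l, hlL, m, hmL, σ, ⟨hσ, hσn⟩, _, hab, rfl⟩)
  have hb0 : Λ.deg b = 0 := by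
    rw [h3, Λ.deg_comp _ _ h2, hsup, hσn] at h4
    exact add_eq_left.mp h4
  rw [comp_of_deg_eq_zero h2 hb0] at h3
  rcases hσ' hσn with hσB | ⟨ρ, hρ, γ, ⟨δ, hδ, hδB⟩, hργ, hργσ⟩
  · exact Or.inr ⟨l, hlL, a, ⟨m, h1, h3 ▸ hσB⟩, hla, rfl⟩
  obtain ⟨u, v, z, huv, huz, hvz, rfl, rfl⟩ := exists_minExt h1 hργ (h3.trans hργσ.symm)
  obtain ⟨hu1, hv1, huv', hu4⟩ := id huv
  simp only at hu1 hv1 huv' hu4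
  have hlu : Λ.src l = Λ.rng u := hs.trans hu1
  have hluP : Λ.comp l u ∈ P := hP.left hl hm hρ.1 hd hs huv
  have hludeg : Λ.deg (Λ.comp l u) + Λ.deg z = n := by
    rw [← hn, ← Λ.comp_assoc _ _ _ hlu huz, Λ.deg_comp (Λ.comp l u) z]
    rw [Λ.src_comp _ _ hlu, huz]
  rcases (hludeg ▸ le_self_add : Λ.deg (Λ.comp l u) ≤ n).eq_or_lt with hun | hun
  · have hz0 : Λ.deg z = 0 := add_eq_left.mp (hun ▸ hludeg)
    rw [comp_of_deg_eq_zero huz hz0]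
    exact Or.inl (Or.inr ⟨l, hlL, m, hmL, ρ, hρ, _, huv, rfl⟩)
  · have hδv : Λ.src δ = Λ.rng v := by rw [hδ, Λ.rng_comp _ _ hvz]
    refine Or.inr ⟨Λ.comp l u, ⟨hluP, hun⟩, z, ⟨Λ.comp δ v, ?_, ?_⟩, ?_, ?_⟩
    · rw [Λ.src_comp _ _ hδv, hvz]
    · rwa [Λ.comp_assoc _ _ _ hδv hvz]
    · rw [Λ.src_comp _ _ hlu, huz]
    · rw [Λ.comp_assoc _ _ _ hlu huz]

theorem finite_piSet (hΛ : Λ.FinitelyAligned) {E : Set Λ.Path} (hE : E.Finite) :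
    (Λ.piSet E).Finite := by
  obtain ⟨N, hN⟩ := (hE.image Λ.deg).bddAbove
  refine ((Set.finite_Iic N).biUnion fun n _ => finite_piSet_inter_deg hΛ hE n).subset ?_
  intro x hx
  simp only [Set.mem_iUnion]
  exact ⟨_, deg_le_of_mem_piSet (fun y hy => hN ⟨y, hy, rfl⟩) x hx, hx, rfl⟩

variable (Λ) in
/-- `Λ.Extends x y` means that `x` is an initial segment of `y`. -/
def Extends (x y : Λ.Path) : Prop := ∃ ν, Λ.src x = Λ.rng ν ∧ Λ.comp x ν = y

theorem Extends.deg_le {x y : Λ.Path} (h : Λ.Extends x y) : Λ.deg x ≤ Λ.deg y := by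
  obtain ⟨ν, h1, rfl⟩ := h
  rw [Λ.deg_comp _ _ h1]
  exact le_self_add

theorem Extends.eq_of_deg_eq {x y : Λ.Path} (h : Λ.Extends x y) (hd : Λ.deg x = Λ.deg y) :
    x = y := by
  obtain ⟨ν, h1, rfl⟩ := h
  rw [Λ.deg_comp _ _ h1] at hd
  exact (comp_of_deg_eq_zero h1 (left_eq_add.mp hd)).symm

section Commutative

variable {B : Type*} [CommRing B] {P : Λ.Path → B}

open Classical in
/-- The product of `P x` with all `1 - P y`, for `y ∈ G` a proper extension of `x`. -/
noncomputable def gap (P : Λ.Path → B) (G : Finset Λ.Path) (x : Λ.Path) : B :=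
  P x * ∏ y ∈ G with Λ.Extends x y ∧ y ≠ x, (1 - P y)

theorem mul_gap_eq_zero_of_extends (hidem : ∀ x, P x * P x = P x) {G : Finset Λ.Path}
    {x y : Λ.Path} (hy : y ∈ G) (hxy : Λ.Extends x y) (hne : y ≠ x) : P y * gap P G x = 0 := by
  classical
  rw [gap, mul_left_comm, ← Finset.mul_prod_erase _ _ (Finset.mem_filter.mpr ⟨hy, hxy, hne⟩),
    ← mul_assoc (P y), mul_sub, mul_one, hidem, sub_self, zero_mul, mul_zero]

theorem mul_gap_eq_zero (hΛ : Λ.FinitelyAligned) (hidem : ∀ x, P x * P x = P x)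
    (hmul : ∀ x y, P x * P y = ∑ p ∈ (hΛ x y).toFinset, P (Λ.comp x p.1))
    {G : Finset Λ.Path} {x y : Λ.Path}
    (hG : ∀ a b, (a, b) ∈ Λ.minExt x y → Λ.comp x a ∈ G) (hxy : ¬ Λ.Extends y x) :
    P y * gap P G x = 0 := by
  have hPx : gap P G x = P x * gap P G x := by rw [gap, ← mul_assoc, hidem]
  rw [hPx, ← mul_assoc, mul_comm (P y), hmul, Finset.sum_mul]
  refine Finset.sum_eq_zero fun p hp => ?_
  rw [Set.Finite.mem_toFinset] at hp
  refine mul_gap_eq_zero_of_extends hidem (hG p.1 p.2 hp) ⟨p.1, hp.1, rfl⟩ fun h => hxy ?_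
  exact ⟨p.2, hp.2.1, hp.2.2.1.symm.trans h⟩

theorem prod_one_sub_add_sum_gap (hΛ : Λ.FinitelyAligned) (hidem : ∀ x, P x * P x = P x)
    (hmul : ∀ x y, P x * P y = ∑ p ∈ (hΛ x y).toFinset, P (Λ.comp x p.1))
    (G : Finset Λ.Path)
    (hG : ∀ x ∈ G, ∀ y ∈ G, ∀ a b, (a, b) ∈ Λ.minExt x y → Λ.comp x a ∈ G) :
    ∏ x ∈ G, (1 - P x) + ∑ x ∈ G, gap P G x = 1 := by
  classical
  induction hc : G.card generalizing G with
  | zero => simp [Finset.card_eq_zero.mp hc]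
  | succ n ih =>
  obtain ⟨x, hx, hmin⟩ := G.exists_minimalFor Λ.deg (Finset.card_pos.mp (by omega))
  have hmin' : ∀ y ∈ G, Λ.Extends y x → y = x := fun y hy h =>
    h.eq_of_deg_eq (le_antisymm h.deg_le (hmin hy h.deg_le))
  have hG' : ∀ y ∈ G.erase x, ∀ z ∈ G.erase x, ∀ a b, (a, b) ∈ Λ.minExt y z →
      Λ.comp y a ∈ G.erase x := by
    intro y hy z hz a b hab
    rw [Finset.mem_erase] at hy hz ⊢
    exact ⟨fun h => hy.1 (hmin' y hy.2 ⟨a, hab.1, h⟩), hG y hy.2 z hz.2 a b hab⟩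
  have hih := ih (G.erase x) hG' (by rw [Finset.card_erase_of_mem hx, hc]; rfl)
  have hsum : ∑ y ∈ G.erase x, gap P (G.erase x) y = ∑ y ∈ G.erase x, gap P G y := by
    refine Finset.sum_congr rfl fun y hy => ?_
    rw [Finset.mem_erase] at hy
    rw [gap, gap]
    congr 2
    ext z
    simp only [Finset.mem_filter, Finset.mem_erase]
    exact ⟨fun h => ⟨h.1.2, h.2⟩, fun h =>
      ⟨⟨fun hzx => hy.1 (hmin' y hy.2 (hzx ▸ h.2.1)), h.1⟩, h.2⟩⟩
  have hgap : P x * ∏ y ∈ G.erase x, (1 - P y) = gap P G x := by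
    have hfilter : (G.erase x).filter (fun y => Λ.Extends x y) =
        G.filter (fun y => Λ.Extends x y ∧ y ≠ x) := by
      ext z
      simp only [Finset.mem_filter, Finset.mem_erase]
      tauto
    rw [← Finset.prod_filter_mul_prod_filter_not _ (fun y => Λ.Extends x y), hfilter,
      ← mul_assoc]
    change gap P G x * _ = gap P G x
    refine Finset.prod_induction _ (fun c => gap P G x * c = gap P G x)
      (fun a b ha hb => by rw [← mul_assoc, ha, hb]) (mul_one _) fun y hy => ?_
    simp only [Finset.mem_filter, Finset.mem_erase] at hy
    rw [mul_sub, mul_one, mul_comm, mul_gap_eq_zero hΛ hidem hmul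
      (hG x hx y hy.1.2) (fun h => hy.1.1 (hmin' y hy.1.2 h)), sub_zero]
  rw [← Finset.mul_prod_erase _ _ hx, ← Finset.add_sum_erase _ _ hx, ← hgap, ← hsum]
  linear_combination hih

theorem sum_gap_of_extends (hΛ : Λ.FinitelyAligned) (hidem : ∀ x, P x * P x = P x)
    (hmul : ∀ x y, P x * P y = ∑ p ∈ (hΛ x y).toFinset, P (Λ.comp x p.1))
    (hle : ∀ x ν, Λ.src x = Λ.rng ν → P x * P (Λ.comp x ν) = P (Λ.comp x ν))
    (G : Finset Λ.Path)
    (hG : ∀ x ∈ G, ∀ y ∈ G, ∀ a b, (a, b) ∈ Λ.minExt x y → Λ.comp x a ∈ G)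
    {l : Λ.Path} (hl : l ∈ G) {S : Finset Λ.Path}
    (hS : ∀ ν, ν ∈ S ↔ Λ.src l = Λ.rng ν ∧ Λ.comp l ν ∈ G) :
    ∑ ν ∈ S, gap P G (Λ.comp l ν) = P l := by
  classical
  have h := congrArg (P l * ·) (prod_one_sub_add_sum_gap hΛ hidem hmul G hG)
  simp only [mul_one] at h
  rw [mul_add, ← Finset.mul_prod_erase _ _ hl, ← mul_assoc, mul_sub, hidem, mul_one, sub_self,
    zero_mul, zero_add, Finset.mul_sum] at h
  rw [← h]
  have hinj : Set.InjOn (fun ν => Λ.comp l ν) S := fun ν hν ν' hν' h =>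
    (comp_inj ((hS ν).1 hν).1 ((hS ν').1 hν').1 rfl h).2
  rw [← Finset.sum_image (f := fun x => gap P G x) hinj]
  have hsub : S.image (fun ν => Λ.comp l ν) ⊆ G := by
    intro x hx
    obtain ⟨ν, hν, rfl⟩ := Finset.mem_image.mp hx
    exact ((hS ν).1 hν).2
  rw [← Finset.sum_subset hsub]
  · refine Finset.sum_congr rfl fun x hx => ?_
    obtain ⟨ν, hν, rfl⟩ := Finset.mem_image.mp hx
    rw [gap, ← mul_assoc, hle l ν ((hS ν).1 hν).1]
  · intro x hx hxS
    refine mul_gap_eq_zero hΛ hidem hmul (hG x hx l hl) fun ⟨ν, h1, h2⟩ => hxS ?_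
    exact Finset.mem_image.mpr ⟨ν, (hS ν).2 ⟨h1, h2 ▸ hx⟩, h2⟩

end Commutative

theorem setProd_map {ι A B : Type*} [CommRing B] [Ring A] (φ : B →+* A) {S : Set ι}
    (hS : S.Finite) (f : ι → B) :
    setProd S (fun i => φ (f i)) = φ (∏ i ∈ hS.toFinset, f i) := by
  rw [setProd, dif_pos hS, ← Finset.prod_map_toList, map_list_prod, List.map_map]
  rfl

section Family

universe u

variable {A : Type u} [Ring A] [StarRing A] {t : Λ.Path → A}

theorem IsCK13.star_mul_self (ht : Λ.IsCK13 t) (l : Λ.Path) : star (t l) * t l = t (Λ.src l) := by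
  have h : Λ.minExt l l = {(Λ.src l, Λ.src l)} := by
    ext ⟨a, b⟩
    rw [Set.mem_singleton_iff, Prod.mk.injEq]
    constructor
    · rintro ⟨h1, h2, h3, h4⟩
      simp only at h1 h2 h3 h4
      have hab := (comp_inj h1 h2 rfl h3).2
      rw [Λ.deg_comp _ _ h1, sup_idem] at h4
      have ha := eq_src_of_deg_eq_zero h1 (add_eq_left.mp h4)
      exact ⟨ha, hab ▸ ha⟩
    · rintro ⟨rfl, rfl⟩
      exact ⟨(rng_src l).symm, (rng_src l).symm, rfl, by
        simp only [Λ.comp_src_self, sup_idem]⟩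
  have hv := ht.vertex_projection _ (Λ.deg_src l)
  rw [ht.ck3, h, setSum, dif_pos (Set.finite_singleton _), Set.Finite.toFinset_singleton,
    Finset.sum_singleton, hv.1, hv.2]

theorem IsCK13.mul_src (ht : Λ.IsCK13 t) (l : Λ.Path) : t l * t (Λ.src l) = t l := by
  rw [ht.comp_mul _ _ (rng_src l).symm, Λ.comp_src_self]

theorem IsCK13.src_mul_star (ht : Λ.IsCK13 t) (l : Λ.Path) :
    t (Λ.src l) * star (t l) = star (t l) := by
  have h := congrArg star (ht.mul_src l)
  rwa [star_mul, (ht.vertex_projection _ (Λ.deg_src l)).1] at h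

theorem IsCK13.rangeProj_mul (ht : Λ.IsCK13 t) (hΛ : Λ.FinitelyAligned) (x y : Λ.Path) :
    t x * star (t x) * (t y * star (t y)) =
      ∑ p ∈ (hΛ x y).toFinset, t (Λ.comp x p.1) * star (t (Λ.comp x p.1)) := by
  have h : t x * star (t x) * (t y * star (t y)) = t x * (star (t x) * t y) * star (t y) := by
    simp only [mul_assoc]
  rw [h, ht.ck3, setSum, dif_pos (hΛ x y), Finset.mul_sum, Finset.sum_mul]
  refine Finset.sum_congr rfl fun p hp => ?_
  rw [Set.Finite.mem_toFinset] at hp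
  nth_rewrite 2 [hp.2.2.1]
  rw [← ht.comp_mul _ _ hp.1, ← ht.comp_mul _ _ hp.2.1, star_mul]
  simp only [mul_assoc]

theorem IsCK13.rangeProj_comm (ht : Λ.IsCK13 t) (hΛ : Λ.FinitelyAligned) (x y : Λ.Path) :
    t x * star (t x) * (t y * star (t y)) = t y * star (t y) * (t x * star (t x)) := by
  have h := congrArg star (ht.rangeProj_mul hΛ x y)
  simp only [star_mul, star_star, star_sum] at h
  rw [h, ht.rangeProj_mul hΛ x y]

open scoped IsMulCommutative in
/-- The range projections of a family lie in a commutative ring. -/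
theorem IsCK13.exists_commRing (ht : Λ.IsCK13 t) (hΛ : Λ.FinitelyAligned) :
    ∃ (B : Type u) (_ : CommRing B) (φ : B →+* A) (P : Λ.Path → B), Function.Injective φ ∧
      ∀ x, φ (P x) = t x * star (t x) := by
  let s : Set A := Set.range fun x => t x * star (t x)
  have hs : ∀ a ∈ s, ∀ b ∈ s, a * b = b * a := by
    rintro _ ⟨x, rfl⟩ _ ⟨y, rfl⟩
    exact ht.rangeProj_comm hΛ x y
  have := Subring.isMulCommutative_closure hs
  exact ⟨Subring.closure s, inferInstance, (Subring.closure s).subtype,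
    fun x => ⟨t x * star (t x), Subring.subset_closure ⟨x, rfl⟩⟩, Subtype.val_injective,
    fun _ => rfl⟩

theorem Qproj_eq_map_gap (hΛ : Λ.FinitelyAligned) {E : Set Λ.Path} (hE : E.Finite)
    {B : Type*} [CommRing B] (φ : B →+* A) {P : Λ.Path → B}
    (hφ : ∀ x, φ (P x) = t x * star (t x)) (hidem : ∀ x, P x * P x = P x)
    (l : Λ.Path) :
    Λ.Qproj t E l = φ (gap P (finite_piSet hΛ hE).toFinset l) := by
  classical
  have hinj : Set.InjOn (fun ν => Λ.comp l ν) (Λ.extInto (Λ.piSet E) l) :=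
    fun ν hν ν' hν' h => (comp_inj hν.1 hν'.1 rfl h).2
  have hfin : (Λ.extInto (Λ.piSet E) l).Finite :=
    Set.Finite.of_injOn (fun ν hν => hν.2.2) hinj (finite_piSet hΛ hE)
  have himage : hfin.toFinset.image (fun ν => Λ.comp l ν) =
      {y ∈ (finite_piSet hΛ hE).toFinset | Λ.Extends l y ∧ y ≠ l} := by
    ext y
    simp only [Finset.mem_image, Set.Finite.mem_toFinset, Finset.mem_filter]
    constructor
    · rintro ⟨ν, ⟨h1, h2, h3⟩, rfl⟩
      refine ⟨h3, ⟨ν, h1, rfl⟩, fun h => h2 ?_⟩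
      have := congrArg Λ.deg h
      rw [Λ.deg_comp _ _ h1] at this
      exact add_eq_left.mp this
    · rintro ⟨h3, ⟨ν, h1, rfl⟩, h2⟩
      exact ⟨ν, ⟨h1, fun h => h2 (comp_of_deg_eq_zero h1 h), h3⟩, rfl⟩
  have hprod : ∀ s : Finset Λ.Path, (∀ ν ∈ s, Λ.src l = Λ.rng ν) →
      P l * ∏ ν ∈ s, (P l - P (Λ.comp l ν)) = P l * ∏ ν ∈ s, (1 - P (Λ.comp l ν)) := by
    intro s
    induction s using Finset.induction_on with
    | empty => simp
    | insert a s ha ih =>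
      intro hs
      have ih := ih fun ν hν => hs ν (Finset.mem_insert_of_mem hν)
      rw [Finset.prod_insert ha, Finset.prod_insert ha, mul_left_comm, ih]
      linear_combination
        (∏ ν ∈ s, (1 - P (Λ.comp l ν))) * hidem l
  have := setProd_map φ hfin (fun ν => P l - P (Λ.comp l ν))
  simp only [map_sub, hφ] at this
  rw [Qproj, this, ← hφ, ← map_mul, hprod _ fun ν hν => ((Set.Finite.mem_toFinset _).1 hν).1, gap,
    ← himage, Finset.prod_image]
  simpa using hinj

end Family

end KGraph

/-- for `l,m ∈ ΠE` with `d(l)=d(m)`, `s(l)=s(m)`,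
`t_l t_m^* = Σ_{ν : lν ∈ ΠE} Θ(t,E;lν,mν)`. -/
theorem stmt10 {k : ℕ} (Λ : KGraph k) (hΛ : Λ.FinitelyAligned)
    (E : Set Λ.Path) (hE : E.Finite) {A : Type*} [CStarAlgebra A]
    (t : Λ.Path → A) (ht : Λ.IsCKFamily t)
    (l m : Λ.Path) (hl : l ∈ Λ.piSet E) (hm : m ∈ Λ.piSet E)
    (hdeg : Λ.deg l = Λ.deg m) (hsrc : Λ.src l = Λ.src m) :
    t l * star (t m) =
      setSum {ν : Λ.Path | Λ.src l = Λ.rng ν ∧ Λ.comp l ν ∈ Λ.piSet E}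
        (fun ν => Λ.Theta t E (Λ.comp l ν) (Λ.comp m ν)) := by
  have ht' := ht.toIsCK13
  obtain ⟨B, _, φ, P, hinj, hφ⟩ := ht'.exists_commRing hΛ
  have hidem : ∀ x, P x * P x = P x := fun x => hinj <| by
    rw [map_mul, hφ, ← mul_assoc, ht'.partialIsometry]
  have hmul : ∀ x y, P x * P y = ∑ p ∈ (hΛ x y).toFinset, P (Λ.comp x p.1) := fun x y =>
    hinj <| by simp only [map_mul, map_sum, hφ, ht'.rangeProj_mul hΛ]
  have hle : ∀ x ν, Λ.src x = Λ.rng ν → P x * P (Λ.comp x ν) = P (Λ.comp x ν) :=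
    fun x ν hx => hinj <| by
      rw [map_mul, hφ, hφ, ← ht'.comp_mul x ν hx, mul_assoc (t x) (t ν), ← mul_assoc _ (t x),
        ht'.partialIsometry]
  have hF := KGraph.finite_piSet hΛ hE
  set S : Set Λ.Path := {ν | Λ.src l = Λ.rng ν ∧ Λ.comp l ν ∈ Λ.piSet E} with hS
  have hSfin : S.Finite := Set.Finite.of_injOn (f := fun ν => Λ.comp l ν) (fun ν hν => hν.2)
    (fun ν hν ν' hν' h => (KGraph.comp_inj hν.1 hν'.1 rfl h).2) hF
  have hterm : ∀ ν ∈ hSfin.toFinset, Λ.Theta t E (Λ.comp l ν) (Λ.comp m ν) =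
      φ (KGraph.gap P hF.toFinset (Λ.comp l ν)) * (t l * star (t m)) := by
    intro ν hν
    have hlν : Λ.src l = Λ.rng ν := ((Set.Finite.mem_toFinset _).1 hν).1
    have hmid : t (Λ.comp l ν) * star (t (Λ.comp m ν)) =
        φ (P (Λ.comp l ν)) * (t l * star (t m)) := by
      rw [hφ, ← ht'.comp_mul _ _ hlν, ← ht'.comp_mul _ _ (hsrc ▸ hlν), star_mul, star_mul]
      simp only [mul_assoc]
      rw [← mul_assoc (star (t l)), ht'.star_mul_self, hsrc, ht'.src_mul_star]
    rw [KGraph.Theta, KGraph.Qproj_eq_map_gap hΛ hE φ hφ hidem, hmid, ← mul_assoc, ← map_mul,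
      mul_comm (KGraph.gap P _ _), KGraph.gap, ← mul_assoc (P _), hidem]
  rw [setSum, dif_pos hSfin, Finset.sum_congr rfl hterm, ← Finset.sum_mul, ← map_sum,
    KGraph.sum_gap_of_extends hΛ hidem hmul hle hF.toFinset ?_ (hF.mem_toFinset.2 hl)
      (fun ν => by simp [hS]), hφ, ← mul_assoc, ht'.partialIsometry]
  intro x hx y hy a b hab
  rw [Set.Finite.mem_toFinset] at *
  exact (KGraph.daggerClosed_piSet E).left hx hx hy rfl rfl hab
end

section
/- Let (Λ,d) be a finitely aligned k-graph, E ⊆ Λ finite, and {t_λ : λ ∈ Λ} a Cuntz–Krieger Λ-family. Let λ ∈ ΠE be such that T(λ) is not exhaustive, and let ξ ∈ s(λ)Λ satisfy Λ^min(ξ,ν) = ∅ for all ν ∈ T(λ). Then t_{λξ} t_{λξ}* ≤ Q(t)^{ΠE}_λ. -/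
open scoped BigOperators

theorem IsStarProjection.list_prod {A : Type*} [Ring A] [StarRing A] (L : List A)
    (hL : ∀ x ∈ L, IsStarProjection x) (hcomm : ∀ x ∈ L, ∀ y ∈ L, Commute x y) :
    IsStarProjection L.prod := by
  induction L with
  | nil => simp [IsStarProjection.one]
  | cons a L ih =>
    rw [List.prod_cons]
    refine (hL a (by simp)).mul (ih (fun x hx => hL x (by simp [hx]))
      fun x hx y hy => hcomm x (by simp [hx]) y (by simp [hy])) ?_
    exact Commute.list_prod_right L a fun x hx => hcomm a (by simp) x (by simp [hx])

theorem List.prod_mul_eq_of_forall_mul_eq {M : Type*} [Monoid M] (L : List M) (e : M)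
    (h : ∀ x ∈ L, x * e = e) : L.prod * e = e := by
  induction L with
  | nil => simp
  | cons a L ih =>
    rw [List.prod_cons, mul_assoc, ih fun x hx => h x (by simp [hx]), h a (by simp)]

theorem setProd_mul_eq_of_forall_mul_eq {ι M : Type*} [Monoid M] (S : Set ι) (f : ι → M) (e : M)
    (h : ∀ i ∈ S, f i * e = e) : setProd S f * e = e := by
  unfold setProd
  split_ifs
  · apply List.prod_mul_eq_of_forall_mul_eq
    simpa using h
  · simp

theorem commute_setProd {ι M : Type*} [Monoid M] (S : Set ι) (f : ι → M) (a : M)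
    (h : ∀ i ∈ S, Commute a (f i)) : Commute a (setProd S f) := by
  unfold setProd
  split_ifs
  · apply Commute.list_prod_right
    simpa using h
  · exact Commute.one_right a

theorem isStarProjection_setProd {ι A : Type*} [Ring A] [StarRing A] (S : Set ι) (f : ι → A)
    (hf : ∀ i ∈ S, IsStarProjection (f i)) (hcomm : ∀ i ∈ S, ∀ j ∈ S, Commute (f i) (f j)) :
    IsStarProjection (setProd S f) := by
  unfold setProd
  split_ifs
  · apply IsStarProjection.list_prod
    · simpa using hf
    · simpa using hcomm
  · exact IsStarProjection.one A

namespace KGraph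

theorem comp_left_cancel {k : ℕ} (Λ : KGraph k) {l a b : Λ.Path} (ha : Λ.src l = Λ.rng a)
    (hb : Λ.src l = Λ.rng b) (h : Λ.comp l a = Λ.comp l b) : a = b := by
  have hdeg : Λ.deg b = Λ.deg a := by
    have := congrArg Λ.deg h
    rw [Λ.deg_comp _ _ ha, Λ.deg_comp _ _ hb] at this
    exact (add_left_cancel this).symm
  have h2 := (Λ.factorisation (Λ.comp l a) _ _ (Λ.deg_comp _ _ ha)).unique
    (y₁ := (l, a)) (y₂ := (l, b)) ⟨rfl, rfl, ha, rfl⟩ ⟨rfl, hdeg, hb, h.symm⟩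
  exact congrArg Prod.snd h2

/-- Prefixing two paths by `l` creates no new minimal common extensions. -/
theorem minExt_of_comp_left {k : ℕ} (Λ : KGraph k) {l m n a b : Λ.Path}
    (hm : Λ.src l = Λ.rng m) (hn : Λ.src l = Λ.rng n)
    (h : (a, b) ∈ Λ.minExt (Λ.comp l m) (Λ.comp l n)) : (a, b) ∈ Λ.minExt m n := by
  obtain ⟨ha, hb, hab, hd⟩ := h
  dsimp only at ha hb hab hd
  rw [Λ.src_comp _ _ hm] at ha
  rw [Λ.src_comp _ _ hn] at hb
  rw [Λ.comp_assoc _ _ _ hm ha] at hab hd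
  rw [Λ.comp_assoc _ _ _ hn hb] at hab
  have hma : Λ.src l = Λ.rng (Λ.comp m a) := by rw [Λ.rng_comp _ _ ha, hm]
  have hnb : Λ.src l = Λ.rng (Λ.comp n b) := by rw [Λ.rng_comp _ _ hb, hn]
  refine ⟨ha, hb, Λ.comp_left_cancel hma hnb hab, ?_⟩
  rw [Λ.deg_comp _ _ hma, Λ.deg_comp _ _ hm, Λ.deg_comp _ _ hn] at hd
  funext i
  have := congrFun hd i
  simp only [Pi.add_apply, Pi.sup_apply] at this ⊢
  omega

namespace IsCK13

variable {k : ℕ} {Λ : KGraph k} {A : Type*} [Ring A] [StarRing A] {t : Λ.Path → A}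

theorem isStarProjection_mul_star (ht : Λ.IsCK13 t) (l : Λ.Path) :
    IsStarProjection (t l * star (t l)) where
  isIdempotentElem := by
    rw [IsIdempotentElem, ← mul_assoc, ht.partialIsometry]
  isSelfAdjoint := IsSelfAdjoint.mul_star_self _

theorem commute_mul_star (ht : Λ.IsCK13 t) (l m : Λ.Path) :
    Commute (t l * star (t l)) (t m * star (t m)) := by
  rw [IsSelfAdjoint.commute_iff (ht.isStarProjection_mul_star l).isSelfAdjoint
    (ht.isStarProjection_mul_star m).isSelfAdjoint]
  have hassoc : t l * star (t l) * (t m * star (t m)) = t l * (star (t l) * t m) * star (t m) := by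
    noncomm_ring
  rw [hassoc, ht.ck3, setSum]
  split_ifs with hfin
  · rw [Finset.mul_sum, Finset.sum_mul]
    refine isSelfAdjoint_sum _ fun p hp => ?_
    obtain ⟨ha, hb, hab, -⟩ := hfin.mem_toFinset.mp hp
    have : t l * (t p.1 * star (t p.2)) * star (t m)
        = t (Λ.comp l p.1) * star (t (Λ.comp l p.1)) := by
      rw [← mul_assoc, ht.comp_mul _ _ ha, mul_assoc, ← star_mul, ht.comp_mul _ _ hb, hab]
    rw [this]
    exact IsSelfAdjoint.mul_star_self _
  · simp

theorem mul_star_mul_mul_star_comp (ht : Λ.IsCK13 t) {l m : Λ.Path} (h : Λ.src l = Λ.rng m) :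
    t l * star (t l) * (t (Λ.comp l m) * star (t (Λ.comp l m)))
      = t (Λ.comp l m) * star (t (Λ.comp l m)) := by
  rw [← mul_assoc, ← ht.comp_mul l m h, ← mul_assoc, ht.partialIsometry]

theorem mul_star_mul_mul_star_eq_zero (ht : Λ.IsCK13 t) {l m : Λ.Path}
    (h : Λ.minExt l m = ∅) : t l * star (t l) * (t m * star (t m)) = 0 := by
  have hz : star (t l) * t m = 0 := by simp [ht.ck3, h, setSum]
  rw [mul_assoc, ← mul_assoc (star (t l)), hz]
  simp

theorem isStarProjection_Qproj (ht : Λ.IsCK13 t) (E : Set Λ.Path) (l : Λ.Path) :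
    IsStarProjection (Λ.Qproj t E l) := by
  have hcomm := ht.commute_mul_star
  refine (ht.isStarProjection_mul_star l).mul (isStarProjection_setProd _ _ ?_ ?_)
    (commute_setProd _ _ _ fun ν _ => (hcomm _ _).sub_right (hcomm _ _))
  · exact fun ν hν => (ht.isStarProjection_mul_star _).sub_of_mul_eq_right
      (ht.isStarProjection_mul_star _) (ht.mul_star_mul_mul_star_comp hν.1)
  · exact fun ν _ μ _ => ((hcomm _ _).sub_right (hcomm _ _)).sub_left
      ((hcomm _ _).sub_right (hcomm _ _))

end IsCK13

end KGraph

/-- if `T(l)` is not exhaustive and `ξ ∈ s(l)Λ` has no common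
extension with any member of `T(l)`, then `t_{lξ} t_{lξ}^* ≤ Q(t)^{ΠE}_l`. -/
theorem stmt12 {k : ℕ} (Λ : KGraph k) (hΛ : Λ.FinitelyAligned)
    (E : Set Λ.Path) (hE : E.Finite)
    {A : Type*} [CStarAlgebra A] [PartialOrder A] [StarOrderedRing A]
    (t : Λ.Path → A) (ht : Λ.IsCKFamily t)
    (l : Λ.Path) (hl : l ∈ Λ.piSet E)
    (hT : ¬ Λ.Exhaustive (Λ.src l) (Λ.extInto (Λ.piSet E) l))
    (ξ : Λ.Path) (hξr : Λ.rng ξ = Λ.src l)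
    (hξ : ∀ ν ∈ Λ.extInto (Λ.piSet E) l, Λ.minExt ξ ν = ∅) :
    t (Λ.comp l ξ) * star (t (Λ.comp l ξ)) ≤ Λ.Qproj t E l := by
  have hck := ht.toIsCK13
  refine (hck.isStarProjection_mul_star _).le_of_mul_eq_right
    (hck.isStarProjection_Qproj E l) ?_
  have hp := hck.mul_star_mul_mul_star_comp hξr.symm
  rw [KGraph.Qproj, mul_assoc, setProd_mul_eq_of_forall_mul_eq, hp]
  intro ν hν
  have hempty : Λ.minExt (Λ.comp l ν) (Λ.comp l ξ) = ∅ := by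
    rw [Set.eq_empty_iff_forall_notMem]
    rintro ⟨a, b⟩ hab
    obtain ⟨ha, hb, heq, hd⟩ := Λ.minExt_of_comp_left hν.1 hξr.symm hab
    have hmem : (b, a) ∈ Λ.minExt ξ ν := ⟨hb, ha, heq.symm, by
      rw [sup_comm, ← hd]
      exact congrArg Λ.deg heq.symm⟩
    simp [hξ ν hν] at hmem
  rw [sub_mul, hp, hck.mul_star_mul_mul_star_eq_zero hempty, sub_zero]
end

section
/- Let (Λ,d) be a finitely aligned k-graph, let v be a vertex, let E ⊆ vΛ be finite and exhaustive, and let μ ∈ vΛ. Then Ext(μ;E) := ⋃_{λ ∈ E} {α : (α,β) ∈ Λ^min(μ,λ) for some β} is a finite exhaustive subset of s(μ)Λ. -/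
open scoped BigOperators

namespace KGraph

variable {k : ℕ} (Λ : KGraph k)

/-- Two factorisations of the same path whose first factors have equal degree agree. -/
theorem comp_inj_of_deg_eq {l a x y : Λ.Path} (hla : Λ.src l = Λ.rng a)
    (hxy : Λ.src x = Λ.rng y) (h : Λ.comp l a = Λ.comp x y) (hd : Λ.deg l = Λ.deg x) :
    l = x ∧ a = y := by
  have hdeg := congrArg Λ.deg h
  rw [Λ.deg_comp _ _ hla, Λ.deg_comp _ _ hxy, hd] at hdeg
  have hd' : Λ.deg a = Λ.deg y := add_left_cancel hdeg
  have huniq := (Λ.factorisation (Λ.comp x y) (Λ.deg x) (Λ.deg y) (Λ.deg_comp _ _ hxy)).unique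
    (y₁ := (l, a)) (y₂ := (x, y)) ⟨hd, hd', hla, h⟩ ⟨rfl, rfl, hxy, rfl⟩
  exact Prod.mk.inj huniq

/-- If `la = xy` and `d(l) ≤ d(x)`, then `l` is an initial segment of `x`. -/
theorem exists_comp_eq_of_deg_le {l a x y : Λ.Path} (hla : Λ.src l = Λ.rng a)
    (hxy : Λ.src x = Λ.rng y) (h : Λ.comp l a = Λ.comp x y) (hd : Λ.deg l ≤ Λ.deg x) :
    ∃ p, Λ.src l = Λ.rng p ∧ Λ.src p = Λ.rng y ∧ Λ.comp l p = x ∧ Λ.comp p y = a := by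
  obtain ⟨⟨z, p⟩, ⟨hz, -, hzp, hx⟩, -⟩ :=
    Λ.factorisation x (Λ.deg l) (Λ.deg x - Λ.deg l) (add_tsub_cancel_of_le hd).symm
  dsimp only at hz hzp hx
  have hpy : Λ.src p = Λ.rng y := by rw [← hxy, ← hx, Λ.src_comp _ _ hzp]
  have hzpy : Λ.src z = Λ.rng (Λ.comp p y) := by rw [Λ.rng_comp _ _ hpy, hzp]
  obtain ⟨rfl, rfl⟩ := Λ.comp_inj_of_deg_eq hla hzpy
    (by rw [h, ← hx, Λ.comp_assoc _ _ _ hzp hpy]) hz.symm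
  exact ⟨p, hzp, hpy, hx, rfl⟩

/-- Every common extension of two paths factors through a minimal one. -/
theorem exists_minExt_of_comp_eq {l m a b : Λ.Path} (hla : Λ.src l = Λ.rng a)
    (hmb : Λ.src m = Λ.rng b) (h : Λ.comp l a = Λ.comp m b) :
    ∃ p q c, (p, q) ∈ Λ.minExt l m ∧ Λ.src p = Λ.rng c ∧ Λ.comp p c = a := by
  have hl : Λ.deg l ≤ Λ.deg (Λ.comp l a) := by
    rw [Λ.deg_comp _ _ hla]; exact le_self_add
  have hm : Λ.deg m ≤ Λ.deg (Λ.comp l a) := by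
    rw [h, Λ.deg_comp _ _ hmb]; exact le_self_add
  obtain ⟨⟨x, c⟩, ⟨hx, -, hxc, hcomp⟩, -⟩ :=
    Λ.factorisation (Λ.comp l a) (Λ.deg l ⊔ Λ.deg m) _
      (add_tsub_cancel_of_le (sup_le hl hm)).symm
  dsimp only at hx hxc hcomp
  obtain ⟨p, hlp, hpc, hp, hpa⟩ :=
    Λ.exists_comp_eq_of_deg_le hla hxc hcomp.symm (hx ▸ le_sup_left)
  obtain ⟨q, hmq, -, hq, -⟩ :=
    Λ.exists_comp_eq_of_deg_le hmb hxc (h.symm.trans hcomp.symm) (hx ▸ le_sup_right)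
  exact ⟨p, q, c, ⟨hlp, hmq, hp.trans hq.symm, hp ▸ hx⟩, hpc, hpa⟩

end KGraph

/-- if `E ⊆ vΛ` is finite and exhaustive and `μ ∈ vΛ`, then
`Ext(μ;E)` is a finite exhaustive subset of `s(μ)Λ`. -/
theorem stmt15 {k : ℕ} (Λ : KGraph k) (hΛ : Λ.FinitelyAligned)
    (v : Λ.Path) (hv : Λ.IsVertex v)
    (E : Set Λ.Path) (hEsub : E ⊆ Λ.withRange v) (hEfin : E.Finite)
    (hEex : Λ.Exhaustive v E)
    (μ : Λ.Path) (hμ : μ ∈ Λ.withRange v) :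
    {α : Λ.Path | ∃ l ∈ E, ∃ β, (α, β) ∈ Λ.minExt μ l}.Finite ∧
    {α : Λ.Path | ∃ l ∈ E, ∃ β, (α, β) ∈ Λ.minExt μ l} ⊆ Λ.withRange (Λ.src μ) ∧
    Λ.Exhaustive (Λ.src μ) {α : Λ.Path | ∃ l ∈ E, ∃ β, (α, β) ∈ Λ.minExt μ l} := by
  refine ⟨?_, ?_, ?_⟩
  · refine (hEfin.biUnion fun l _ => (hΛ μ l).image Prod.fst).subset ?_
    rintro α ⟨l, hl, β, h⟩
    exact Set.mem_biUnion hl ⟨(α, β), h, rfl⟩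
  · rintro α ⟨l, -, β, h⟩
    exact h.1.symm
  · intro σ hσ
    have hμσ : Λ.src μ = Λ.rng σ := Eq.symm hσ
    obtain ⟨l, hl, ⟨γ, δ⟩, hlγ, hσδ, heq, -⟩ :=
      hEex (Λ.comp μ σ) ((Λ.rng_comp _ _ hμσ).trans hμ)
    dsimp only at hlγ hσδ heq
    rw [Λ.src_comp _ _ hμσ] at hσδ
    rw [Λ.comp_assoc _ _ _ hμσ hσδ] at heq
    obtain ⟨α, β, η, hαβ, hαη, hη⟩ := Λ.exists_minExt_of_comp_eq
      (hμσ.trans (Λ.rng_comp _ _ hσδ).symm) hlγ heq.symm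
    obtain ⟨p, q, -, hpq, -⟩ := Λ.exists_minExt_of_comp_eq hαη hσδ hη
    exact ⟨α, ⟨l, hl, β, hαβ⟩, (p, q), hpq⟩
end

section
/- Let (Λ,d) be a finitely aligned k-graph, let v be a vertex, and let E ⊆ vΛ \ {v} be finite and exhaustive. Then I(E) := ⋃_{i=1}^{k} {λ(0,e_i) : λ ∈ E, d(λ)_i > 0} is a finite exhaustive subset of vΛ. -/
open scoped BigOperators

namespace KGraph

variable {k : ℕ} (Λ : KGraph k)

/-- The factorisation of a path with prescribed degree of the first factor is unique. -/
theorem comp_cancel {a b a' b' : Λ.Path} (h : Λ.src a = Λ.rng b) (h' : Λ.src a' = Λ.rng b')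
    (hdeg : Λ.deg a = Λ.deg a') (hcomp : Λ.comp a b = Λ.comp a' b') : a = a' ∧ b = b' := by
  have hb : Λ.deg b' = Λ.deg b := by
    have := congrArg Λ.deg hcomp
    rw [Λ.deg_comp _ _ h, Λ.deg_comp _ _ h', hdeg] at this
    exact (add_left_cancel this).symm
  exact Prod.ext_iff.mp <| (Λ.factorisation (Λ.comp a b) _ _ (Λ.deg_comp a b h)).unique
    (y₁ := (a, b)) (y₂ := (a', b')) ⟨rfl, rfl, h, rfl⟩ ⟨hdeg.symm, hb, h', hcomp.symm⟩

theorem exists_comp_eq {l : Λ.Path} {m : Fin k → ℕ} (h : m ≤ Λ.deg l) :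
    ∃ a b, Λ.deg a = m ∧ Λ.src a = Λ.rng b ∧ Λ.comp a b = l := by
  obtain ⟨p, ⟨h₁, -, h₃, h₄⟩, -⟩ :=
    Λ.factorisation l m (Λ.deg l - m) (add_tsub_cancel_of_le h).symm
  exact ⟨p.1, p.2, h₁, h₃, h₄⟩

/-- If `l` is an initial segment of `ηζ` and `d(l) ≤ d(η)`, then it is one of `η`. -/
theorem exists_comp_eq_of_comp_eq {l a η ζ : Λ.Path} (hl : Λ.src l = Λ.rng a)
    (hη : Λ.src η = Λ.rng ζ) (h : Λ.comp l a = Λ.comp η ζ) (hdeg : Λ.deg l ≤ Λ.deg η) :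
    ∃ c, Λ.src l = Λ.rng c ∧ Λ.comp l c = η := by
  obtain ⟨l', c, hl', hc, rfl⟩ := Λ.exists_comp_eq hdeg
  have hcζ : Λ.src c = Λ.rng ζ := by rw [← Λ.src_comp _ _ hc, hη]
  rw [Λ.comp_assoc _ _ _ hc hcζ] at h
  obtain ⟨rfl, -⟩ := Λ.comp_cancel hl (by rw [hc, Λ.rng_comp _ _ hcζ]) hl'.symm h
  exact ⟨c, hc, rfl⟩

/-- Two paths with a common extension have a minimal common extension. -/
theorem minExt_nonempty {l m a b : Λ.Path} (hl : Λ.src l = Λ.rng a) (hm : Λ.src m = Λ.rng b)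
    (h : Λ.comp l a = Λ.comp m b) : (Λ.minExt l m).Nonempty := by
  have hle : Λ.deg l ⊔ Λ.deg m ≤ Λ.deg (Λ.comp l a) := by
    refine sup_le ?_ ?_
    · rw [Λ.deg_comp _ _ hl]
      exact le_self_add
    · rw [h, Λ.deg_comp _ _ hm]
      exact le_self_add
  obtain ⟨η, ζ, hdeg, hη, hηζ⟩ := Λ.exists_comp_eq hle
  obtain ⟨c, hc, hlc⟩ :=
    Λ.exists_comp_eq_of_comp_eq hl hη hηζ.symm (hdeg ▸ le_sup_left)
  obtain ⟨d, hd, hmd⟩ :=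
    Λ.exists_comp_eq_of_comp_eq hm hη (h.symm.trans hηζ.symm) (hdeg ▸ le_sup_right)
  exact ⟨(c, d), hc, hd, hlc.trans hmd.symm, by rw [hlc, hdeg]⟩

end KGraph

/-- if `E ⊆ vΛ \ {v}` is finite and exhaustive then the set
`I(E) = {λ(0,e_i) : λ ∈ E, d(λ)_i > 0}` of initial edges of members of `E`
is a finite exhaustive subset of `vΛ`. -/
theorem stmt16 {k : ℕ} (Λ : KGraph k) (hΛ : Λ.FinitelyAligned)
    (v : Λ.Path) (hv : Λ.IsVertex v)
    (E : Set Λ.Path) (hEsub : E ⊆ Λ.withRange v) (hvE : v ∉ E)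
    (hEfin : E.Finite) (hEex : Λ.Exhaustive v E) :
    {a : Λ.Path | ∃ i : Fin k, Λ.deg a = Pi.single i 1 ∧
      ∃ l ∈ E, ∃ b, Λ.src a = Λ.rng b ∧ Λ.comp a b = l}.Finite ∧
    {a : Λ.Path | ∃ i : Fin k, Λ.deg a = Pi.single i 1 ∧
      ∃ l ∈ E, ∃ b, Λ.src a = Λ.rng b ∧ Λ.comp a b = l} ⊆ Λ.withRange v ∧
    Λ.Exhaustive v {a : Λ.Path | ∃ i : Fin k, Λ.deg a = Pi.single i 1 ∧
      ∃ l ∈ E, ∃ b, Λ.src a = Λ.rng b ∧ Λ.comp a b = l} := by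
  refine ⟨?_, ?_, ?_⟩
  · refine (hEfin.biUnion fun l _ => Set.finite_iUnion fun i : Fin k =>
      Set.Subsingleton.finite (s := {a | Λ.deg a = Pi.single i 1 ∧
        ∃ b, Λ.src a = Λ.rng b ∧ Λ.comp a b = l}) ?_).subset ?_
    · rintro a ⟨ha, b, hab, rfl⟩ a' ⟨ha', b', hab', h⟩
      exact (Λ.comp_cancel hab hab' (ha.trans ha'.symm) h.symm).1
    · rintro a ⟨i, ha, l, hl, hb⟩
      exact Set.mem_biUnion hl (Set.mem_iUnion.mpr ⟨i, ha, hb⟩)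
  · rintro a ⟨i, -, l, hl, b, hab, rfl⟩
    exact (Λ.rng_comp a b hab).symm.trans (hEsub hl)
  · intro m hm
    obtain ⟨l, hl, ⟨α, β⟩, hα, hβ, hαβ, -⟩ := hEex m hm
    have hdeg : Λ.deg l ≠ 0 := fun h =>
      hvE ((hEsub hl).symm.trans (Λ.rng_eq_of_deg_zero l h) ▸ hl)
    obtain ⟨i, hi⟩ := Function.ne_iff.mp hdeg
    obtain ⟨a, b, ha, hab, rfl⟩ := Λ.exists_comp_eq (l := l) (m := Pi.single i 1) <| by
      intro j
      rcases eq_or_ne j i with rfl | hj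
      · simpa using Nat.one_le_iff_ne_zero.mpr hi
      · simp [hj]
    have hbα : Λ.src b = Λ.rng α := (Λ.src_comp a b hab).symm.trans hα
    refine ⟨a, ⟨i, ha, _, hl, b, hab, rfl⟩, Λ.minExt_nonempty (a := Λ.comp b α) ?_ hβ ?_⟩
    · rw [hab, Λ.rng_comp _ _ hbα]
    · rw [← Λ.comp_assoc _ _ _ hab hbα, hαβ]
end

section
/- Let (Λ,d) be a finitely aligned k-graph and let {t_λ : λ ∈ Λ} be a family of partial isometries in a C*-algebra satisfying relations (CK1)–(CK3). Let v be a vertex, let λ ∈ vΛ, and suppose E ⊆ s(λ)Λ is a finite set with ∏_{ν ∈ E} (t_{s(λ)} − t_ν t_ν*) = 0. Then t_v − t_λ t_λ* = ∏_{ν ∈ E} (t_v − t_{λν} t_{λν}*). -/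
open scoped BigOperators

theorem List.mul_prod_eq_self_of_forall {M : Type*} [Monoid M] {y : M} {L : List M}
    (h : ∀ x ∈ L, y * x = y) : y * L.prod = y := by
  induction L with
  | nil => simp
  | cons a L ih =>
    rw [List.prod_cons, ← mul_assoc, h a (by simp)]
    exact ih fun x hx => h x (by simp [hx])

theorem List.mul_prod_map_intertwine {ι M : Type*} [Monoid M] {y : M} {L : List ι} {f g : ι → M}
    (h : ∀ i ∈ L, y * f i = g i * y) : y * (L.map f).prod = (L.map g).prod * y := by
  induction L with
  | nil => simp
  | cons a L ih =>
    rw [List.map_cons, List.map_cons, List.prod_cons, List.prod_cons, ← mul_assoc, h a (by simp),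
      mul_assoc, ih fun i hi => h i (by simp [hi]), mul_assoc]

namespace KGraph

theorem src_src {k : ℕ} (Λ : KGraph k) (l : Λ.Path) : Λ.src (Λ.src l) = Λ.src l :=
  Λ.src_eq_of_deg_zero _ (Λ.deg_src l)

theorem rng_src_s17 {k : ℕ} (Λ : KGraph k) (l : Λ.Path) : Λ.rng (Λ.src l) = Λ.src l :=
  Λ.rng_eq_of_deg_zero _ (Λ.deg_src l)

theorem src_rng {k : ℕ} (Λ : KGraph k) (l : Λ.Path) : Λ.src (Λ.rng l) = Λ.rng l :=
  Λ.src_eq_of_deg_zero _ (Λ.deg_rng l)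

theorem minExt_self {k : ℕ} (Λ : KGraph k) (l : Λ.Path) :
    Λ.minExt l l = {(Λ.src l, Λ.src l)} := by
  ext ⟨a, b⟩
  simp only [minExt, Set.mem_ofPred_eq, Set.mem_singleton_iff, Prod.mk.injEq, sup_idem]
  constructor
  · rintro ⟨ha, hb, hab, hd⟩
    have hda : Λ.deg a = 0 := by
      rw [Λ.deg_comp l a ha] at hd
      exact left_eq_add.mp hd.symm
    have hdb : Λ.deg b = 0 := by
      rw [hab, Λ.deg_comp l b hb] at hd
      exact left_eq_add.mp hd.symm
    rw [ha, Λ.rng_eq_of_deg_zero a hda, and_iff_right rfl, ← Λ.rng_eq_of_deg_zero b hdb, ← hb, ha,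
      Λ.rng_eq_of_deg_zero a hda]
  · rintro ⟨rfl, rfl⟩
    simp [rng_src_s17, comp_src_self]

namespace IsCK13

variable {k : ℕ} {Λ : KGraph k} {A : Type*} [Ring A] [StarRing A] {t : Λ.Path → A}

theorem mul_src_s17 (ht : Λ.IsCK13 t) (l : Λ.Path) : t l * t (Λ.src l) = t l := by
  rw [ht.comp_mul _ _ (Λ.rng_src_s17 l).symm, Λ.comp_src_self]

theorem rng_mul (ht : Λ.IsCK13 t) (l : Λ.Path) : t (Λ.rng l) * t l = t l := by
  rw [ht.comp_mul _ _ (Λ.src_rng l), Λ.rng_comp_self]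

theorem star_mul_rng (ht : Λ.IsCK13 t) (l : Λ.Path) :
    star (t l) * t (Λ.rng l) = star (t l) := by
  have h := congrArg star (ht.rng_mul l)
  rwa [star_mul, (ht.vertex_projection _ (Λ.deg_rng l)).1] at h

theorem src_mul_star_s17 (ht : Λ.IsCK13 t) (l : Λ.Path) :
    t (Λ.src l) * star (t l) = star (t l) := by
  have h := congrArg star (ht.mul_src_s17 l)
  rwa [star_mul, (ht.vertex_projection _ (Λ.deg_src l)).1] at h

theorem star_mul_self_s17 (ht : Λ.IsCK13 t) (l : Λ.Path) : star (t l) * t l = t (Λ.src l) := by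
  obtain ⟨hs, hm⟩ := ht.vertex_projection _ (Λ.deg_src l)
  rw [ht.ck3, minExt_self, setSum, dif_pos (Set.finite_singleton _)]
  simp [hs, hm]

theorem star_mul_sub_range (ht : Λ.IsCK13 t) {l ν : Λ.Path} (h : Λ.src l = Λ.rng ν) :
    star (t l) * (t (Λ.rng l) - t (Λ.comp l ν) * star (t (Λ.comp l ν))) =
      (t (Λ.src l) - t ν * star (t ν)) * star (t l) := by
  have hν : t (Λ.src l) * t ν = t ν := h ▸ ht.rng_mul ν
  rw [← ht.comp_mul l ν h, star_mul, mul_sub, sub_mul, ht.star_mul_rng, ht.src_mul_star_s17,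
    mul_assoc (t l), ← mul_assoc (star (t l)), ht.star_mul_self_s17, ← mul_assoc, hν, mul_assoc]

theorem sub_mul_sub_range (ht : Λ.IsCK13 t) {l ν : Λ.Path} (h : Λ.src l = Λ.rng ν) :
    (t (Λ.rng l) - t l * star (t l)) *
        (t (Λ.rng l) - t (Λ.comp l ν) * star (t (Λ.comp l ν))) =
      t (Λ.rng l) - t l * star (t l) := by
  have hl : (t (Λ.rng l) - t l * star (t l)) * t l = 0 := by
    rw [sub_mul, ht.rng_mul, ht.partialIsometry, sub_self]
  rw [mul_sub, ← mul_assoc _ (t (Λ.comp l ν)), ← ht.comp_mul l ν h, ← mul_assoc _ (t l), hl,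
    zero_mul, zero_mul, sub_zero, sub_mul, mul_assoc, ht.star_mul_rng,
    (ht.vertex_projection _ (Λ.deg_rng l)).2]

theorem rng_mul_sub_range (ht : Λ.IsCK13 t) {l ν : Λ.Path} (h : Λ.src l = Λ.rng ν) :
    t (Λ.rng l) * (t (Λ.rng l) - t (Λ.comp l ν) * star (t (Λ.comp l ν))) =
      t (Λ.rng l) - t (Λ.comp l ν) * star (t (Λ.comp l ν)) := by
  rw [mul_sub, (ht.vertex_projection _ (Λ.deg_rng l)).2, ← mul_assoc, ← Λ.rng_comp l ν h,
    ht.rng_mul]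

theorem sub_range_eq_list_prod (ht : Λ.IsCK13 t) {l : Λ.Path} {L : List Λ.Path}
    (hL : ∀ ν ∈ L, Λ.src l = Λ.rng ν)
    (hprod : (L.map fun ν => t (Λ.src l) - t ν * star (t ν)).prod = 0) :
    t (Λ.rng l) - t l * star (t l) =
      (L.map fun ν => t (Λ.rng l) - t (Λ.comp l ν) * star (t (Λ.comp l ν))).prod := by
  obtain rfl | hne := eq_or_ne L []
  · have : Subsingleton A := subsingleton_of_zero_eq_one (by simpa using hprod.symm)
    exact Subsingleton.elim _ _
  set P := (L.map fun ν => t (Λ.rng l) - t (Λ.comp l ν) * star (t (Λ.comp l ν))).prod with hP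
  have hrng : t (Λ.rng l) * P = P := by
    obtain ⟨ν, L, rfl⟩ := List.exists_cons_of_ne_nil hne
    rw [hP, List.map_cons, List.prod_cons, ← mul_assoc, ht.rng_mul_sub_range (hL ν (by simp))]
  have hstar : star (t l) * P = 0 := by
    rw [hP, List.mul_prod_map_intertwine fun ν hν => ht.star_mul_sub_range (hL ν hν), hprod,
      zero_mul]
  have hsub : (t (Λ.rng l) - t l * star (t l)) * P = t (Λ.rng l) - t l * star (t l) := by
    refine List.mul_prod_eq_self_of_forall fun x hx => ?_
    obtain ⟨ν, hν, rfl⟩ := List.mem_map.mp hx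
    exact ht.sub_mul_sub_range (hL ν hν)
  rw [← hsub, sub_mul, hrng, mul_assoc, hstar, mul_zero, sub_zero]

end IsCK13

end KGraph

/-- if `E ⊆ s(l)Λ` is finite with `∏_{ν ∈ E}(t_{s(l)} - t_ν t_ν^*) = 0`,
then `t_v - t_l t_l^* = ∏_{ν ∈ E}(t_v - t_{lν} t_{lν}^*)`. -/
theorem stmt17 {k : ℕ} (Λ : KGraph k) (hΛ : Λ.FinitelyAligned)
    {A : Type*} [CStarAlgebra A] (t : Λ.Path → A) (ht : Λ.IsCK13 t)
    (v : Λ.Path) (hv : Λ.IsVertex v) (l : Λ.Path) (hl : l ∈ Λ.withRange v)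
    (E : Set Λ.Path) (hEsub : E ⊆ Λ.withRange (Λ.src l)) (hEfin : E.Finite)
    (hprod : setProd E (fun ν => t (Λ.src l) - t ν * star (t ν)) = 0) :
    t v - t l * star (t l) =
      setProd E (fun ν => t v - t (Λ.comp l ν) * star (t (Λ.comp l ν))) := by
  obtain rfl : Λ.rng l = v := hl
  rw [setProd, dif_pos hEfin] at hprod ⊢
  exact ht.sub_range_eq_list_prod (fun ν hν => (hEsub (by simpa using hν)).symm) hprod
end
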